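/- arXiv:2305.08065 — 3 statements merged into one kernel-verified Lean document; each statement's English description precedes it below -/
import Mathlib

section
/- For d ≥ 3 and m < d, every group homomorphism from SL_d(ℤ) to GL_m(ℂ) is trivial. -/
namespace Module.End

section Field

variable {K V : Type*} [Field K] [AddCommGroup V] [Module K V]

theorem exists_common_eigenvector [IsAlgClosed K] [FiniteDimensional K V] {ι : Type*}
    (f : ι → End K V) (hf : ∀ i j, Commute (f i) (f j)) {i₀ : ι} {lam : K}
    (h₀ : (f i₀).HasEigenvalue lam) (s : Finset ι) :
    ∃ v ≠ 0, f i₀ v = lam • v ∧ ∀ i ∈ s, ∃ μ : K, f i v = μ • v := by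
  classical
  induction s using Finset.induction_on with
  | empty =>
    obtain ⟨v, hv⟩ := h₀.exists_hasEigenvector
    exact ⟨v, hv.2, hv.apply_eq_smul, by simp⟩
  | insert a s ha ih =>
    obtain ⟨v, hv0, hv, hs⟩ := ih
    choose! μ hμ using hs
    let E : Submodule K V := (f i₀).eigenspace lam ⊓ ⨅ i ∈ s, (f i).eigenspace (μ i)
    have hE : ∀ x, x ∈ E ↔ f i₀ x = lam • x ∧ ∀ i ∈ s, f i x = μ i • x := by
      simp [E, Submodule.mem_iInf]
    have hmap : ∀ x ∈ E, f a x ∈ E := by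
      intro x hx
      rw [hE] at hx ⊢
      have hc : ∀ i, f i (f a x) = f a (f i x) := fun i => LinearMap.congr_fun (hf i a).eq x
      exact ⟨by rw [hc, hx.1, map_smul], fun i hi => by rw [hc, hx.2 i hi, map_smul]⟩
    have : Nontrivial E := ⟨⟨⟨v, (hE v).2 ⟨hv, hμ⟩⟩, 0, fun h => hv0 (congrArg Subtype.val h)⟩⟩
    obtain ⟨c, hc⟩ := exists_eigenvalue ((f a).restrict hmap)
    obtain ⟨w, hw⟩ := hc.exists_hasEigenvector
    have hwE := (hE w).1 w.2
    refine ⟨w, fun h => hw.2 (Subtype.ext h), hwE.1, fun i hi => ?_⟩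
    rcases Finset.mem_insert.1 hi with rfl | hi
    · exact ⟨c, congrArg Subtype.val hw.apply_eq_smul⟩
    · exact ⟨μ i, hwE.2 i hi⟩

/-- Joint eigenvectors of a commuting family with distinct systems of eigenvalues are linearly
independent. -/
theorem linearIndependent_of_injective_eigenvalues {ι κ : Type*} (f : ι → End K V)
    (hf : ∀ i j, Commute (f i) (f j)) {χ : κ → ι → K} (hχ : Function.Injective χ) {v : κ → V}
    (hv0 : ∀ k, v k ≠ 0) (hv : ∀ k i, f i (v k) = χ k i • v k) : LinearIndependent K v := by
  have hind := (independent_iInf_maxGenEigenspace_of_forall_mapsTo f fun i j φ =>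
    mapsTo_maxGenEigenspace_of_comm (hf j i) φ).comp hχ
  refine hind.linearIndependent _ (fun k => ?_) hv0
  rw [Function.comp_apply, mem_iInf_maxGenEigenspace_iff]
  exact fun i => ⟨1, by simp [hv]⟩

theorem isNilpotent_sub_one_of_forall_hasEigenvalue [IsAlgClosed K] [FiniteDimensional K V]
    {f : End K V} (hf : ∀ c, f.HasEigenvalue c → c = 1) : IsNilpotent (f - 1) := by
  have htop : f.maxGenEigenspace 1 = ⊤ := by
    rw [← iSup_maxGenEigenspace_eq_top f]
    refine le_antisymm (le_iSup (fun c => f.maxGenEigenspace c) 1) (iSup_le fun c => ?_)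
    by_cases hc : c = 1
    · rw [hc]
    · have : f.maxGenEigenspace c = ⊥ := by
        rw [maxGenEigenspace_eq_genEigenspace_finrank]
        by_contra h
        exact hc (hf c (hasEigenvalue_of_hasGenEigenvalue (k := finrank K V) h))
      rw [this]
      exact bot_le
  refine ⟨finrank K V, ?_⟩
  rw [maxGenEigenspace_eq_genEigenspace_finrank, genEigenspace_nat, one_smul] at htop
  exact LinearMap.ker_eq_top.1 htop

theorem exists_forall_apply_eq_zero_of_isNilpotent [Nontrivial V] {ι : Type*}
    (f : ι → End K V) (hf : ∀ i j, Commute (f i) (f j)) (hnil : ∀ i, IsNilpotent (f i))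
    (s : Finset ι) : ∃ v ≠ 0, ∀ i ∈ s, f i v = 0 := by
  classical
  induction s using Finset.induction_on with
  | empty => simpa using exists_ne (0 : V)
  | insert a s ha ih =>
    obtain ⟨v, hv0, hv⟩ := ih
    have hex : ∃ n, (f a ^ n) v = 0 := (hnil a).imp fun n hn => by rw [hn]; rfl
    obtain ⟨n, hn⟩ : ∃ n, Nat.find hex = n + 1 := Nat.exists_eq_succ_of_ne_zero fun h =>
      hv0 (by simpa [h] using Nat.find_spec hex)
    refine ⟨(f a ^ n) v, Nat.find_min hex (by lia), fun i hi => ?_⟩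
    rcases Finset.mem_insert.1 hi with rfl | hi
    · rw [← Module.End.mul_apply, ← pow_succ', ← hn]
      exact Nat.find_spec hex
    · rw [← Module.End.mul_apply, ((hf i a).pow_right n).eq, Module.End.mul_apply, hv i hi, map_zero]

theorem eq_one_of_isNilpotent_sub_one [FiniteDimensional K V] (hV : finrank K V ≤ 1)
    {f : End K V} (hf : IsNilpotent (f - 1)) : f = 1 := by
  have h := LinearMap.aeval_self_charpoly (f - 1)
  rw [hf.charpoly_eq_X_pow_finrank, map_pow, Polynomial.aeval_X] at h
  exact sub_eq_zero.1 (by simpa using pow_eq_zero_of_le hV h)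

theorem commute_of_sub_mem {W : Submodule K V} {f g : End K V}
    (hfW : ∀ w ∈ W, f w = w) (hgW : ∀ w ∈ W, g w = w)
    (hf : ∀ v, f v - v ∈ W) (hg : ∀ v, g v - v ∈ W) : Commute f g := by
  refine LinearMap.ext fun v => ?_
  have h1 := hfW _ (hg v)
  have h2 := hgW _ (hf v)
  rw [map_sub, sub_eq_iff_eq_add] at h1 h2
  change f (g v) = g (f v)
  rw [h1, h2]
  abel

end Field

/-- A family of endomorphisms satisfying the Steinberg relations of elementary matrices. -/
structure IsSteinbergFamily {ι K V : Type*} [Field K] [AddCommGroup V] [Module K V]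
    (A : ι → ι → End K V) : Prop where
  mul_eq : ∀ {i j k}, i ≠ j → j ≠ k → i ≠ k → A i j * A j k = A i k * (A j k * A i j)
  commute : ∀ {i j k l}, i ≠ j → k ≠ l → j ≠ k → i ≠ l → Commute (A i j) (A k l)

namespace IsSteinbergFamily

section

variable {ι K V : Type*} [Field K] [AddCommGroup V] [Module K V] {A : ι → ι → End K V}

theorem mul_apply_eq (hA : IsSteinbergFamily A) {i j k : ι} (hij : i ≠ j) (hjk : j ≠ k)
    (hik : i ≠ k) (v : V) : A i j (A j k v) = A i k (A j k (A i j v)) :=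
  LinearMap.congr_fun (hA.mul_eq hij hjk hik) v

theorem commute_apply (hA : IsSteinbergFamily A) {i j k l : ι} (hij : i ≠ j) (hkl : k ≠ l)
    (hjk : j ≠ k) (hil : i ≠ l) (v : V) : A i j (A k l v) = A k l (A i j v) :=
  LinearMap.congr_fun (hA.commute hij hkl hjk hil).eq v

/-- If the members of index `(i, o)` have a joint eigenvector `v`, then `A k l v` is also a joint
eigenvector, the `l`-th eigenvalue being divided by the `k`-th one. -/
theorem apply_eigenvector [DecidableEq ι] (hA : IsSteinbergFamily A) {o : ι} {v : V} {μ : ι → K}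
    (hv : ∀ i ≠ o, A i o v = μ i • v) {k l : ι} (hk : k ≠ o) (hl : l ≠ o) (hkl : k ≠ l)
    (hμ : μ k ≠ 0) :
    ∀ i ≠ o, A i o (A k l v) = Function.update μ l (μ l / μ k) i • A k l v := by
  intro i hi
  by_cases hil : i = l
  · subst hil
    have h := hA.mul_apply_eq hkl hi hk v
    rw [hv i hi, map_smul, ← hA.commute_apply hi hk hk.symm hi,
      hA.commute_apply hk hkl hk.symm hkl, hv k hk, map_smul, map_smul] at h
    rw [Function.update_self, div_eq_inv_mul, mul_smul, h, inv_smul_smul₀ hμ]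
  · rw [hA.commute_apply hi hkl hk.symm hil, hv i hi, map_smul, Function.update_of_ne hil]

theorem eq_one_of_hasEigenvalue [Fintype ι] [IsAlgClosed K] [FiniteDimensional K V]
    (hA : IsSteinbergFamily A) (hinj : ∀ i j, i ≠ j → Function.Injective (A i j))
    (hcard : 3 ≤ Fintype.card ι) (hV : finrank K V < Fintype.card ι) {i₀ o : ι} (hi₀ : i₀ ≠ o)
    {lam : K} (hlam : (A i₀ o).HasEigenvalue lam) : lam = 1 := by
  classical
  by_contra hne
  obtain ⟨k, hk₀, hko⟩ : ∃ k, k ≠ i₀ ∧ k ≠ o := by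
    obtain ⟨k, -, hk⟩ := Finset.exists_mem_notMem_of_card_lt_card (s := {i₀, o}) (t := Finset.univ)
      (Finset.card_le_two.trans_lt (by rw [Finset.card_univ]; omega))
    exact ⟨k, by simpa using hk⟩
  have hne0 : ∀ {i j : ι} {v : V}, i ≠ j → v ≠ 0 → A i j v ≠ 0 := fun hij hv h =>
    hv (hinj _ _ hij (h.trans (map_zero _).symm))
  have hμ0 : ∀ {μ : ι → K} {v : V}, v ≠ 0 → (∀ i ≠ o, A i o v = μ i • v) → ∀ i ≠ o, μ i ≠ 0 :=
    fun hv0 hv i hi h => hne0 hi hv0 (by rw [hv i hi, h, zero_smul])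
  let f : ι → End K V := fun i => if i = o then 1 else A i o
  have hfo : f o = 1 := if_pos rfl
  have hfi : ∀ i ≠ o, f i = A i o := fun i hi => if_neg hi
  have hf : ∀ i j, Commute (f i) (f j) := by
    intro i j
    by_cases hi : i = o
    · rw [hi, hfo]; exact Commute.one_left _
    by_cases hj : j = o
    · rw [hj, hfo]; exact Commute.one_right _
    rw [hfi i hi, hfi j hj]
    exact hA.commute hi hj (Ne.symm hj) hi
  obtain ⟨v, μ, hv0, hv, h₀, hk⟩ : ∃ (v : V) (μ : ι → K), v ≠ 0 ∧ (∀ i ≠ o, A i o v = μ i • v) ∧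
      μ i₀ ≠ 1 ∧ μ k ≠ 1 := by
    obtain ⟨v, hv0, hvlam, hv⟩ := exists_common_eigenvector f hf
      (show (f i₀).HasEigenvalue lam by rwa [hfi i₀ hi₀]) Finset.univ
    choose μ hμ using fun i => hv i (Finset.mem_univ i)
    have hAv : ∀ i ≠ o, A i o v = μ i • v := fun i hi => by rw [← hfi i hi, hμ]
    have hμ₀ : μ i₀ = lam := smul_left_injective K hv0 ((hμ i₀).symm.trans hvlam)
    by_cases hμk : μ k = 1
    · refine ⟨A i₀ k v, _, hne0 hk₀.symm hv0,
        hA.apply_eigenvector hAv hi₀ hko hk₀.symm (hμ0 hv0 hAv i₀ hi₀), ?_, ?_⟩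
      · rwa [Function.update_of_ne hk₀.symm, hμ₀]
      · rw [Function.update_self, hμk, hμ₀]
        simpa using hne
    · exact ⟨v, μ, hv0, hAv, hμ₀ ▸ hne, hμk⟩
  let j : ι → ι := fun i => if i = i₀ then k else i₀
  have hjo : ∀ i, j i ≠ o := fun i => by dsimp only [j]; split_ifs <;> assumption
  have hji : ∀ i, j i ≠ i := fun i => by
    dsimp only [j]; split_ifs with h
    · exact h ▸ hk₀
    · exact Ne.symm h
  have hj1 : ∀ i, μ (j i) ≠ 1 := fun i => by dsimp only [j]; split_ifs <;> assumption
  have hjdiv : ∀ i ≠ o, μ i / μ (j i) ≠ μ i := fun i hi h => hj1 i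
    (by rwa [div_eq_iff (hμ0 hv0 hv _ (hjo i)), left_eq_mul₀ (hμ0 hv0 hv i hi)] at h)
  let χ' : ι → ι → K := fun i => if i = o then μ else Function.update μ i (μ i / μ (j i))
  let χ : ι → ι → K := fun i => Function.update (χ' i) o 1
  let w : ι → V := fun i => if i = o then v else A (j i) i v
  have hw : ∀ i, ∀ l ≠ o, A l o (w i) = χ' i l • w i := by
    intro i
    by_cases hi : i = o
    · simpa only [w, χ', if_pos hi] using hv
    · simpa only [w, χ', if_neg hi] using
        hA.apply_eigenvector hv (hjo i) hi (hji i) (hμ0 hv0 hv _ (hjo i))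
  have hχ_ne : ∀ i i', i ≠ o → i ≠ i' → χ i ≠ χ i' := by
    intro i i' hi hii' h
    have h' := congrFun h i
    by_cases hi' : i' = o
    · simp only [χ, χ', Function.update_of_ne hi, if_neg hi, if_pos hi', Function.update_self] at h'
      exact hjdiv i hi h'
    · simp only [χ, χ', Function.update_of_ne hi, if_neg hi, if_neg hi', Function.update_self,
        Function.update_of_ne hii'] at h'
      exact hjdiv i hi h'
  have hχ : Function.Injective χ := by
    intro i i' h
    by_contra hii'
    by_cases hi : i = o
    · exact hχ_ne i' i (fun h' => hii' (hi.trans h'.symm)) (Ne.symm hii') h.symm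
    · exact hχ_ne i i' hi hii' h
  have hli : LinearIndependent K w := by
    refine linearIndependent_of_injective_eigenvalues f hf hχ (fun i => ?_) fun i l => ?_
    · dsimp only [w]
      split_ifs
      · exact hv0
      · exact hne0 (hji i) hv0
    · by_cases hl : l = o
      · subst hl
        simp [hfo, χ]
      · rw [hfi l hl, hw i l hl]
        simp only [χ, Function.update_of_ne hl]
  exact hV.not_ge hli.fintype_card_le_finrank

theorem eq_one_of_apply_eq_one [Fintype ι] (hA : IsSteinbergFamily A)
    (hunit : ∀ i j, i ≠ j → IsUnit (A i j)) (hcard : 3 ≤ Fintype.card ι) {i j : ι} (hij : i ≠ j)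
    (h : A i j = 1) : ∀ k l, k ≠ l → A k l = 1 := by
  classical
  have hrow : ∀ {i j k}, i ≠ j → i ≠ k → A i j = 1 → A i k = 1 := by
    intro i j k hij hik h
    by_cases hjk : j = k
    · exact hjk ▸ h
    · have := hA.mul_eq hij hjk hik
      rw [h, one_mul, mul_one] at this
      exact ((hunit j k hjk).mul_eq_right.1 this.symm)
  have hcol : ∀ {i j k}, i ≠ j → k ≠ j → A i j = 1 → A k j = 1 := by
    intro i j k hij hkj h
    by_cases hki : k = i
    · exact hki ▸ h
    · have := hA.mul_eq hki hij hkj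
      rw [h, one_mul, mul_one] at this
      exact ((hunit k i hki).mul_eq_right.1 this.symm)
  intro k l hkl
  by_cases hli : l = i
  · subst hli
    obtain ⟨m, -, hm⟩ := Finset.exists_mem_notMem_of_card_lt_card (s := {l, j}) (t := Finset.univ)
      (Finset.card_le_two.trans_lt (by rw [Finset.card_univ]; omega))
    have hm : m ≠ l ∧ m ≠ j := by simpa using hm
    exact hcol hm.1 hkl (hrow hm.2 hm.1 (hcol hij hm.2 h))
  · exact hcol (Ne.symm hli) hkl (hrow hij (Ne.symm hli) h)

end

universe u v

theorem eq_one_of_isNilpotent {K : Type*} [Field K] (n : ℕ) :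
    ∀ {ι : Type u} [Fintype ι] {V : Type v} [AddCommGroup V] [Module K V]
      [FiniteDimensional K V] {A : ι → ι → End K V}, IsSteinbergFamily A →
      (∀ i j, i ≠ j → IsNilpotent (A i j - 1)) → Fintype.card ι = n → finrank K V < n →
      ∀ i j, i ≠ j → A i j = 1 := by
  classical
  induction n with
  | zero => intros; omega
  | succ n ih =>
  intro ι _ V _ _ _ A hA hnil hcard hV
  rcases le_or_gt n 1 with hn | hn
  · exact fun i j hij => eq_one_of_isNilpotent_sub_one (by omega) (hnil i j hij)
  have hunit : ∀ i j, i ≠ j → IsUnit (A i j) := fun i j hij => by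
    simpa using (hnil i j hij).isUnit_one_add
  have hthird : ∀ s : Finset ι, s.card ≤ n → ∃ k, k ∉ s := fun s hs => by
    obtain ⟨k, -, hk⟩ := Finset.exists_mem_notMem_of_card_lt_card (s := s) (t := Finset.univ)
      (by rw [Finset.card_univ]; omega)
    exact ⟨k, hk⟩
  obtain ⟨o, -⟩ := hthird ∅ (by simp)
  obtain ⟨a, ha⟩ := hthird {o} (by simpa using hn.le)
  have hao : a ≠ o := by simpa using ha
  obtain ⟨b, hb⟩ := hthird {a, o} (Finset.card_le_two.trans hn)
  obtain ⟨hba, hbo⟩ : b ≠ a ∧ b ≠ o := by simpa using hb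
  suffices ∃ i j, i ≠ j ∧ A i j = 1 by
    obtain ⟨i, j, hij, h⟩ := this
    exact hA.eq_one_of_apply_eq_one hunit (by omega) hij h
  -- the fixed space of the abelian group generated by the `A i o`
  let W : Submodule K V := ⨅ i : {i // i ≠ o}, LinearMap.ker (A i o - 1)
  have hW : ∀ v, v ∈ W ↔ ∀ i ≠ o, A i o v = v := by
    simp [W, Submodule.mem_iInf, sub_eq_zero]
  by_cases htriv : finrank K (V ⧸ W) = 0
  · refine ⟨a, o, hao, LinearMap.ext fun v => (hW v).1 ?_ a hao⟩
    have := finrank_zero_iff.1 htriv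
    rw [Submodule.Quotient.subsingleton_iff.1 this]
    trivial
  have hsum := W.finrank_quotient_add_finrank
  have : Nontrivial V := nontrivial_of_finrank_pos (R := K) (by omega)
  have hWbot : finrank K W ≠ 0 := by
    obtain ⟨v, hv0, hv⟩ := exists_forall_apply_eq_zero_of_isNilpotent
      (fun i : {i // i ≠ o} => A i o - 1)
      (fun i j => (((hA.commute i.2 j.2 j.2.symm i.2).sub_left (Commute.one_left _)).sub_right
        (Commute.one_right _))) (fun i => hnil i o i.2) Finset.univ
    have hvW : v ∈ W := (hW v).2 fun i hi => sub_eq_zero.1 (hv ⟨i, hi⟩ (Finset.mem_univ _))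
    intro h
    exact hv0 ((Submodule.mem_bot K).1 (Submodule.finrank_eq_zero.1 h ▸ hvW))
  have hmap : ∀ i j, i ≠ j → i ≠ o → ∀ w ∈ W, A i j w ∈ W := by
    intro i j hij hi w hw
    rw [hW] at hw ⊢
    intro k hk
    by_cases hj : j = o
    · subst hj; rw [hw i hi, hw k hk]
    by_cases hkj : k = j
    · subst hkj
      have h := hA.mul_apply_eq hij hk hi w
      rwa [hw k hk, ← hA.commute_apply hk hi hi.symm hk, hA.commute_apply hi hij hi.symm hij,
        hw i hi, eq_comm] at h
    · rw [hA.commute_apply hk hij hi.symm hkj, hw k hk]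
  have hnilW : ∀ i j (hij : i ≠ j) (hi : i ≠ o),
      IsNilpotent ((A i j).restrict (hmap i j hij hi) - 1) := by
    intro i j hij hi
    obtain ⟨m, hm⟩ := hnil i j hij
    refine ⟨m, LinearMap.ext fun w => Subtype.ext ?_⟩
    have : ∀ (m : ℕ) (w : W), (((A i j).restrict (hmap i j hij hi) - 1) ^ m) w =
        ((A i j - 1) ^ m) (w : V) := by
      intro m
      induction m with
      | zero => simp
      | succ m ihm => intro w; rw [pow_succ, pow_succ, mul_apply, mul_apply, ihm]; rfl
    rw [this, hm]
    rfl
  have hnilQ : ∀ i j (hij : i ≠ j) (hi : i ≠ o),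
      IsNilpotent (W.mapQ W (A i j) (hmap i j hij hi) - 1) := by
    intro i j hij hi
    obtain ⟨m, hm⟩ := hnil i j hij
    have : ∀ (m : ℕ) (v : V), ((W.mapQ W (A i j) (hmap i j hij hi) - 1) ^ m) (W.mkQ v) =
        W.mkQ (((A i j - 1) ^ m) v) := by
      intro m
      induction m with
      | zero => simp
      | succ m ihm => intro v; rw [pow_succ, pow_succ, mul_apply, mul_apply, ← ihm]; rfl
    refine ⟨m, Submodule.linearMap_qext _ (LinearMap.ext fun v => ?_)⟩
    rw [LinearMap.comp_apply, this, hm]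
    simp
  have hcard' : Fintype.card {i // i ≠ o} = n := by
    simp [Fintype.card_subtype_compl, hcard]
  have honeW : ∀ i j, i ≠ j → i ≠ o → j ≠ o → ∀ w ∈ W, A i j w = w := by
    intro i j hij hi hj w hw
    let B : {i // i ≠ o} → {i // i ≠ o} → End K W := fun i j =>
      if h : i ≠ j then (A i j).restrict (hmap i j (Subtype.coe_ne_coe.2 h) i.2) else 1
    have hBdef : ∀ i j (h : i ≠ j) (w : W), (B i j w : V) = A i j w := fun i j h w => by
      simp only [B, dif_pos h]; rfl
    have hB : IsSteinbergFamily B := by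
      constructor
      · intro i j k hij hjk hik
        ext w
        simp only [mul_apply, hBdef _ _ hij, hBdef _ _ hjk, hBdef _ _ hik]
        exact hA.mul_apply_eq (Subtype.coe_ne_coe.2 hij) (Subtype.coe_ne_coe.2 hjk)
          (Subtype.coe_ne_coe.2 hik) _
      · intro i j k l hij hkl hjk hil
        ext w
        simp only [mul_apply, hBdef _ _ hij, hBdef _ _ hkl]
        exact hA.commute_apply (Subtype.coe_ne_coe.2 hij) (Subtype.coe_ne_coe.2 hkl)
          (Subtype.coe_ne_coe.2 hjk) (Subtype.coe_ne_coe.2 hil) _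
    have hij' : (⟨i, hi⟩ : {i // i ≠ o}) ≠ ⟨j, hj⟩ := fun h => hij (congrArg Subtype.val h)
    have := ih hB (fun i j h => by
      simp only [B, dif_pos h]; exact hnilW i j (Subtype.coe_ne_coe.2 h) i.2) hcard' (by omega)
      ⟨i, hi⟩ ⟨j, hj⟩ hij'
    rw [← hBdef _ _ hij' ⟨w, hw⟩, this]
    rfl
  have honeQ : ∀ i j, i ≠ j → i ≠ o → j ≠ o → ∀ v, A i j v - v ∈ W := by
    intro i j hij hi hj v
    let B : {i // i ≠ o} → {i // i ≠ o} → End K (V ⧸ W) := fun i j =>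
      if h : i ≠ j then W.mapQ W (A i j) (hmap i j (Subtype.coe_ne_coe.2 h) i.2) else 1
    have hBdef : ∀ i j (h : i ≠ j) (v : V), B i j (W.mkQ v) = W.mkQ (A i j v) := fun i j h v => by
      simp only [B, dif_pos h]; rfl
    have hB : IsSteinbergFamily B := by
      constructor
      · intro i j k hij hjk hik
        refine Submodule.linearMap_qext _ (LinearMap.ext fun v => ?_)
        simp only [LinearMap.comp_apply, mul_apply, hBdef _ _ hij, hBdef _ _ hjk, hBdef _ _ hik]
        rw [hA.mul_apply_eq (Subtype.coe_ne_coe.2 hij) (Subtype.coe_ne_coe.2 hjk)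
          (Subtype.coe_ne_coe.2 hik)]
      · intro i j k l hij hkl hjk hil
        refine Submodule.linearMap_qext _ (LinearMap.ext fun v => ?_)
        simp only [LinearMap.comp_apply, mul_apply, hBdef _ _ hij, hBdef _ _ hkl]
        rw [hA.commute_apply (Subtype.coe_ne_coe.2 hij) (Subtype.coe_ne_coe.2 hkl)
          (Subtype.coe_ne_coe.2 hjk) (Subtype.coe_ne_coe.2 hil)]
    have hij' : (⟨i, hi⟩ : {i // i ≠ o}) ≠ ⟨j, hj⟩ := fun h => hij (congrArg Subtype.val h)
    have := ih hB (fun i j h => by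
      simp only [B, dif_pos h]; exact hnilQ i j (Subtype.coe_ne_coe.2 h) i.2) hcard' (by omega)
      ⟨i, hi⟩ ⟨j, hj⟩ hij'
    have h2 := hBdef _ _ hij' v
    rw [this] at h2
    exact (Submodule.Quotient.eq W).1 h2.symm
  rcases Nat.lt_or_eq_of_le hn with hn | hn
  · obtain ⟨c, hc⟩ := hthird {a, b, o} (Finset.card_le_three.trans hn)
    obtain ⟨hca, hcb, hco⟩ : c ≠ a ∧ c ≠ b ∧ c ≠ o := by simpa using hc
    have hcomm : Commute (A a c) (A c b) := commute_of_sub_mem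
      (honeW a c hca.symm hao hco) (honeW c b hcb hco hbo)
      (honeQ a c hca.symm hao hco) (honeQ c b hcb hco hbo)
    refine ⟨a, b, hba.symm, ?_⟩
    have h := hA.mul_eq hca.symm hcb hba.symm
    rw [hcomm.eq] at h
    exact ((hunit c b hcb).mul (hunit a c hca.symm)).mul_eq_right.1 h.symm
  · have hbQ : W.mapQ W (A b o) (hmap b o hbo hbo) = 1 :=
      eq_one_of_isNilpotent_sub_one (by omega) (hnilQ b o hbo hbo)
    have hcomm : Commute (A a b) (A b o) := commute_of_sub_mem
      (honeW a b hba.symm hao hbo) (fun w hw => (hW w).1 hw b hbo)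
      (honeQ a b hba.symm hao hbo)
      (fun v => (Submodule.Quotient.eq W).1 (LinearMap.congr_fun hbQ (W.mkQ v)))
    refine ⟨a, o, hao, ?_⟩
    have h := hA.mul_eq hba.symm hbo hao
    rw [hcomm.eq] at h
    exact ((hunit b o hbo).mul (hunit a b hba.symm)).mul_eq_right.1 h.symm

end IsSteinbergFamily

end Module.End

theorem Int.exists_natAbs_add_mul_lt {x y : ℤ} (hx : x ≠ 0) (hxy : x.natAbs ≤ y.natAbs) :
    ∃ c : ℤ, (y + c * x).natAbs < y.natAbs := by
  rcases le_total 0 (x * y) with h | h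
  · refine ⟨-1, ?_⟩
    rcases lt_or_gt_of_ne hx with h' | h'
    · have : y ≤ 0 := by nlinarith
      omega
    · have : 0 ≤ y := by nlinarith
      omega
  · refine ⟨1, ?_⟩
    rcases lt_or_gt_of_ne hx with h' | h'
    · have : 0 ≤ y := by nlinarith
      omega
    · have : y ≤ 0 := by nlinarith
      omega

namespace Matrix.SpecialLinearGroup

variable {ι : Type*} [Fintype ι] [DecidableEq ι]

theorem transvection_mul_apply {R : Type*} [CommRing R] {i j : ι} (hij : i ≠ j) (c : R)
    (g : SpecialLinearGroup ι R) (k l : ι) :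
    (transvection hij c * g) k l = if k = i then g i l + c * g j l else g k l := by
  rw [coe_mul]
  change (Matrix.transvection i j c * (g : Matrix ι ι R)) k l = _
  split_ifs with h
  · subst h
    exact Matrix.transvection_mul_apply_same k j l c _
  · exact Matrix.transvection_mul_apply_of_ne i j k l h c _

theorem transvection_mul_mem_iff {R : Type*} [CommRing R] {H : Subgroup (SpecialLinearGroup ι R)}
    (hH : ∀ (i j : ι) (hij : i ≠ j) (c : R), transvection hij c ∈ H) {i j : ι} (hij : i ≠ j)
    (c : R) (g : SpecialLinearGroup ι R) : transvection hij c * g ∈ H ↔ g ∈ H :=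
  H.mul_mem_cancel_left (hH i j hij c)

/-- If the columns of `g` outside `T` are standard basis vectors, this remains true after
adding a multiple of a row in `T` to another row. -/
theorem transvection_mul_apply_of_forall_notMem {R : Type*} [CommRing R] {i j : ι} (hij : i ≠ j)
    (c : R) {g : SpecialLinearGroup ι R} {T : Finset ι} (hj : j ∈ T)
    (hg : ∀ l ∉ T, ∀ k, g k l = (1 : Matrix ι ι R) k l) :
    ∀ l ∉ T, ∀ k, (transvection hij c * g) k l = (1 : Matrix ι ι R) k l := by
  intro l hl k
  rw [transvection_mul_apply]
  split_ifs with h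
  · subst h
    rw [hg l hl, hg l hl, one_apply_ne (fun h : j = l => hl (h ▸ hj))]
    simp
  · exact hg l hl k

theorem transvection_mul_transvection {R : Type*} [CommRing R] {i j k : ι} (hij : i ≠ j)
    (hjk : j ≠ k) (hik : i ≠ k) :
    transvection hij (1 : R) * transvection hjk 1 =
      transvection hik 1 * (transvection hjk 1 * transvection hij 1) := by
  apply Subtype.ext
  rw [coe_mul, coe_mul, coe_mul]
  simp only [transvection_coe, mul_add, add_mul, one_mul, mul_one, single_mul_single_same,
    single_mul_single_of_ne _ _ _ _ hjk.symm, single_mul_single_of_ne _ _ _ _ hik.symm, add_zero]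
  abel

theorem commute_transvection {R : Type*} [CommRing R] {i j k l : ι} (hij : i ≠ j) (hkl : k ≠ l)
    (hjk : j ≠ k) (hil : i ≠ l) : Commute (transvection hij (1 : R)) (transvection hkl 1) := by
  apply Subtype.ext
  rw [coe_mul, coe_mul]
  simp only [transvection_coe, mul_add, add_mul, one_mul, mul_one,
    single_mul_single_of_ne _ _ _ _ hjk, single_mul_single_of_ne _ _ _ _ hil.symm]
  abel

theorem mem_of_apply_eq_one {H : Subgroup (SpecialLinearGroup ι ℤ)}
    (hH : ∀ (i j : ι) (hij : i ≠ j) (c : ℤ), transvection hij c ∈ H) {T : Finset ι} {a : ι}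
    (ih : ∀ g : SpecialLinearGroup ι ℤ, (∀ l ∉ T, ∀ k, g k l = (1 : Matrix ι ι ℤ) k l) → g ∈ H)
    (D : Finset ι) :
    ∀ g : SpecialLinearGroup ι ℤ, (∀ l ∉ insert a T, ∀ k, g k l = (1 : Matrix ι ι ℤ) k l) →
      g a a = 1 → (∀ i ∉ D, i ≠ a → g i a = 0) → g ∈ H := by
  induction D using Finset.induction_on with
  | empty =>
    intro g hg h1 h0
    refine ih g fun l hl k => ?_
    by_cases hla : l = a
    · subst hla
      by_cases hk : k = l
      · subst hk; simpa using h1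
      · rw [h0 k (by simp) hk, one_apply_ne hk]
    · exact hg l (by simp [hla, hl]) k
  | insert b D hb ihD =>
    intro g hg h1 h0
    by_cases hba : b = a
    · exact ihD g hg h1 fun i hi hia => h0 i (by simp [hi, hia, hba]) hia
    · rw [← transvection_mul_mem_iff hH hba (-g b a)]
      refine ihD _ (transvection_mul_apply_of_forall_notMem hba _ (by simp) hg) ?_ ?_
      · rw [transvection_mul_apply, if_neg (Ne.symm hba), h1]
      · intro i hi hia
        rw [transvection_mul_apply]
        split_ifs with h
        · simp [h1]
        · exact h0 i (by simp [h, hi]) hia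

theorem mem_of_isUnit_apply {H : Subgroup (SpecialLinearGroup ι ℤ)}
    (hH : ∀ (i j : ι) (hij : i ≠ j) (c : ℤ), transvection hij c ∈ H) {T : Finset ι} {a : ι}
    (ih : ∀ g : SpecialLinearGroup ι ℤ, (∀ l ∉ T, ∀ k, g k l = (1 : Matrix ι ι ℤ) k l) → g ∈ H)
    {q : ι} (hq : q ∈ T) (hqa : q ≠ a) (g : SpecialLinearGroup ι ℤ)
    (hg : ∀ l ∉ insert a T, ∀ k, g k l = (1 : Matrix ι ι ℤ) k l) (hu : IsUnit (g q a)) :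
    g ∈ H := by
  obtain ⟨u, hu⟩ := hu.exists_right_inv
  rw [← transvection_mul_mem_iff hH hqa.symm (u * (1 - g a a))]
  refine mem_of_apply_eq_one hH ih Finset.univ _
    (transvection_mul_apply_of_forall_notMem _ _ (by simp [hq]) hg) ?_ (by simp)
  rw [transvection_mul_apply, if_pos rfl]
  linear_combination (1 - g a a) * hu

theorem mem_of_sum_natAbs {H : Subgroup (SpecialLinearGroup ι ℤ)}
    (hH : ∀ (i j : ι) (hij : i ≠ j) (c : ℤ), transvection hij c ∈ H) {T : Finset ι} {a : ι}
    (ha : a ∉ T)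
    (ih : ∀ g : SpecialLinearGroup ι ℤ, (∀ l ∉ T, ∀ k, g k l = (1 : Matrix ι ι ℤ) k l) → g ∈ H)
    (n : ℕ) : ∀ g : SpecialLinearGroup ι ℤ,
    (∀ l ∉ insert a T, ∀ k, g k l = (1 : Matrix ι ι ℤ) k l) →
      ∑ i ∈ insert a T, (g i a).natAbs = n → g ∈ H := by
  induction n using Nat.strong_induction_on with
  | _ n ihn =>
  intro g hg hn
  by_cases hpair : ∃ i ∈ insert a T, ∃ k ∈ insert a T, i ≠ k ∧ g i a ≠ 0 ∧ g k a ≠ 0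
  · obtain ⟨i, hi, k, hk, hik, hi0, hle⟩ : ∃ i ∈ insert a T, ∃ k ∈ insert a T,
        i ≠ k ∧ g i a ≠ 0 ∧ (g i a).natAbs ≤ (g k a).natAbs := by
      obtain ⟨i, hi, k, hk, hik, hi0, hk0⟩ := hpair
      rcases le_total (g i a).natAbs (g k a).natAbs with h | h
      · exact ⟨i, hi, k, hk, hik, hi0, h⟩
      · exact ⟨k, hk, i, hi, hik.symm, hk0, h⟩
    obtain ⟨c, hc⟩ := Int.exists_natAbs_add_mul_lt hi0 hle
    rw [← transvection_mul_mem_iff hH hik.symm c]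
    refine ihn _ ?_ _ (transvection_mul_apply_of_forall_notMem _ _ hi hg) rfl
    rw [← hn]
    refine Finset.sum_lt_sum (fun l _ => ?_) ⟨k, hk, ?_⟩
    · rw [transvection_mul_apply]
      split_ifs with h
      · exact h ▸ hc.le
      · exact le_rfl
    · rwa [transvection_mul_apply, if_pos rfl]
  · push Not at hpair
    have hsum : ∑ i ∈ insert a T, g⁻¹ a i * g i a = 1 := by
      have h1 : ∀ l, ∑ i, g⁻¹ a i * g i l = (1 : Matrix ι ι ℤ) a l := fun l => by
        rw [← Matrix.mul_apply, ← coe_mul, inv_mul_cancel, coe_one]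
      refine Eq.trans ?_ ((h1 a).trans (one_apply_eq a))
      refine Finset.sum_subset (Finset.subset_univ _) fun l _ hl => ?_
      have h2 := h1 l
      simp only [hg l hl, one_apply, mul_ite, mul_one, mul_zero, Finset.sum_ite_eq',
        Finset.mem_univ, if_true] at h2
      rw [h2, if_neg (fun h : a = l => hl (by simp [h])), zero_mul]
    obtain ⟨p, hp, hp0⟩ : ∃ p ∈ insert a T, g p a ≠ 0 := by
      by_contra! h
      rw [Finset.sum_eq_zero fun i hi => by rw [h i hi, mul_zero]] at hsum
      exact zero_ne_one hsum
    have hunit : IsUnit (g p a) := by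
      rw [Finset.sum_eq_single_of_mem p hp fun i hi hip => by
        rw [hpair p hp i hi hip.symm hp0, mul_zero]] at hsum
      exact IsUnit.of_mul_eq_one_right _ hsum
    by_cases hpa : p = a
    · subst hpa
      rcases T.eq_empty_or_nonempty with rfl | ⟨q, hq⟩
      · refine mem_of_apply_eq_one hH ih Finset.univ g hg ?_ (by simp)
        have hcol : (g : Matrix ι ι ℤ) = updateCol 1 p (fun i => g i p) := by
          ext i l
          by_cases hl : l = p
          · subst hl; simp
          · rw [updateCol_ne hl]
            exact hg l (by simpa using hl) i
        have hdet := g.det_coe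
        rw [hcol, ← cramer_apply, cramer_one] at hdet
        simpa using hdet
      · have hqp : q ≠ p := fun h => ha (h ▸ hq)
        rw [← transvection_mul_mem_iff hH hqp 1]
        refine mem_of_isUnit_apply hH ih hq hqp _
          (transvection_mul_apply_of_forall_notMem _ _ hp hg) ?_
        rw [transvection_mul_apply, if_pos rfl, hpair p hp q (by simp [hq]) hqp.symm hp0]
        simpa using hunit
    · exact mem_of_isUnit_apply hH ih (Finset.mem_of_mem_insert_of_ne hp hpa) hpa g hg hunit

/-- `SL(ι, ℤ)` is generated by transvections. -/
theorem eq_top_of_forall_transvection_mem {H : Subgroup (SpecialLinearGroup ι ℤ)}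
    (hH : ∀ (i j : ι) (hij : i ≠ j) (c : ℤ), transvection hij c ∈ H) : H = ⊤ := by
  have key : ∀ T : Finset ι, ∀ g : SpecialLinearGroup ι ℤ,
      (∀ l ∉ T, ∀ k, g k l = (1 : Matrix ι ι ℤ) k l) → g ∈ H := by
    intro T
    induction T using Finset.induction_on with
    | empty =>
      intro g hg
      have : g = 1 := SpecialLinearGroup.ext _ _ fun i j => by simpa using hg j (by simp) i
      exact this ▸ H.one_mem
    | insert a T ha ih => exact fun g hg => mem_of_sum_natAbs hH ha ih _ g hg rfl
  exact eq_top_iff.2 fun g _ => key Finset.univ g (by simp)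

open _root_.Module

/-- The images of the elementary matrices under a representation of `SL(ι, ℤ)`. -/
noncomputable def elementaryImage {V : Type*} [AddCommGroup V]
    [Module ℂ V] (ψ : SpecialLinearGroup ι ℤ →* End ℂ V) (i j : ι) : End ℂ V :=
  if h : i ≠ j then ψ (transvection h 1) else 1

theorem elementaryImage_of_ne {V : Type*} [AddCommGroup V]
    [Module ℂ V] (ψ : SpecialLinearGroup ι ℤ →* End ℂ V) {i j : ι} (h : i ≠ j) :
    elementaryImage ψ i j = ψ (transvection h 1) :=
  dif_pos h

theorem isSteinbergFamily_elementaryImage {V : Type*} [AddCommGroup V] [Module ℂ V]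
    (ψ : SpecialLinearGroup ι ℤ →* End ℂ V) :
    _root_.Module.End.IsSteinbergFamily (elementaryImage ψ) where
  mul_eq hij hjk hik := by
    simp only [elementaryImage_of_ne ψ hij, elementaryImage_of_ne ψ hjk,
      elementaryImage_of_ne ψ hik, ← map_mul]
    rw [transvection_mul_transvection hij hjk hik]
  commute hij hkl hjk hil := by
    rw [elementaryImage_of_ne ψ hij, elementaryImage_of_ne ψ hkl]
    exact (commute_transvection hij hkl hjk hil).map ψ

theorem monoidHom_end_eq_one {V : Type*} [AddCommGroup V] [Module ℂ V] [FiniteDimensional ℂ V]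
    (hι : 3 ≤ Fintype.card ι) (hV : finrank ℂ V < Fintype.card ι)
    (ψ : SpecialLinearGroup ι ℤ →* End ℂ V) (g : SpecialLinearGroup ι ℤ) : ψ g = 1 := by
  have hA := isSteinbergFamily_elementaryImage ψ
  have hunit : ∀ i j, i ≠ j → IsUnit (elementaryImage ψ i j) := fun i j hij => by
    rw [elementaryImage_of_ne ψ hij]
    exact (Group.isUnit _).map ψ
  have hnil : ∀ i j, i ≠ j → IsNilpotent (elementaryImage ψ i j - 1) := fun i j hij =>
    End.isNilpotent_sub_one_of_forall_hasEigenvalue fun c hc =>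
      hA.eq_one_of_hasEigenvalue
        (fun i j hij => ((End.isUnit_iff _).1 (hunit i j hij)).injective) hι hV hij hc
  have hone := End.IsSteinbergFamily.eq_one_of_isNilpotent _ hA hnil rfl hV
  have htop : ψ.ker = ⊤ := by
    refine eq_top_of_forall_transvection_mem fun i j hij c => ?_
    have h1 : transvection hij (1 : ℤ) ∈ ψ.ker := by
      rw [MonoidHom.mem_ker, ← elementaryImage_of_ne ψ hij, hone i j hij]
    induction c with
    | zero => rw [transvection_coeff_zero]; exact one_mem _
    | succ n hn => rw [transvection_add]; exact mul_mem hn h1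
    | pred n hn =>
      rw [sub_eq_add_neg, transvection_add, ← transvection_inv hij 1]
      exact mul_mem hn (inv_mem h1)
  exact MonoidHom.mem_ker.1 (htop ▸ Subgroup.mem_top g)

end Matrix.SpecialLinearGroup

/-- For `d ≥ 3` and `m < d`, every group homomorphism `SL_d(ℤ) → GL_m(ℂ)` is trivial. -/
theorem hom_SL_to_smaller_GL_is_trivial (d m : ℕ) (hd : 3 ≤ d) (hm : m < d)
    (φ : Matrix.SpecialLinearGroup (Fin d) ℤ →* GL (Fin m) ℂ) :
    ∀ x, φ x = 1 := by
  intro x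
  have h := Matrix.SpecialLinearGroup.monoidHom_end_eq_one (V := Fin m → ℂ) (by simpa using hd)
    (by simpa using hm) ((Matrix.toLinAlgEquiv' (R := ℂ) (n := Fin m) : _ →* _).comp
      ((Units.coeHom _).comp φ)) x
  exact Units.ext ((Matrix.toLinAlgEquiv' (R := ℂ) (n := Fin m)).injective
    (h.trans (map_one _).symm))
end

section
/- For d ≥ 2 and 0 < r < d, and for any nontrivial finitely generated abelian group A, the SL_d(ℤ)-module Λ^r(ℤ^d) ⊗ A (with the action induced by the standard action on ℤ^d) has no nonzero invariants. -/
open ExteriorAlgebra TensorProduct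

/-- An endomorphism of a module maps the `n`-th exterior power into itself. -/
theorem exteriorAlgebra_map_mem_exteriorPower {R M : Type*} [CommRing R] [AddCommGroup M]
    [Module R M] (f : M →ₗ[R] M) (n : ℕ) {x : ExteriorAlgebra R M} (hx : x ∈ ⋀[R]^n M) :
    ExteriorAlgebra.map f x ∈ ⋀[R]^n M := by
  have h : Submodule.map (ExteriorAlgebra.map f).toLinearMap (⋀[R]^n M) ≤ ⋀[R]^n M := by
    rw [← ιMulti_span_fixedDegree, Submodule.map_span, Submodule.span_le]
    rintro _ ⟨_, ⟨v, rfl⟩, rfl⟩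
    exact Submodule.subset_span ⟨f ∘ v, (map_apply_ιMulti f v).symm⟩
  exact h (Submodule.mem_map_of_mem hx)

/-- The endomorphism of the `n`-th exterior power induced by an endomorphism of the module. -/
def exteriorPowerMap {R M : Type*} [CommRing R] [AddCommGroup M] [Module R M]
    (n : ℕ) (f : M →ₗ[R] M) : ⋀[R]^n M →ₗ[R] ⋀[R]^n M :=
  (ExteriorAlgebra.map f).toLinearMap.restrict
    (fun _ hx => exteriorAlgebra_map_mem_exteriorPower f n hx)

/-- The pairing of the `n`-th exterior power with an `n`-tuple of linear forms is natural. -/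
theorem alternatingMapToDual_comp_exteriorPowerMap {R M : Type*} [CommRing R] [AddCommGroup M]
    [Module R M] (n : ℕ) (φ : M →ₗ[R] M) (f : Fin n → Module.Dual R M) :
    exteriorPower.alternatingMapToDual R M n f ∘ₗ exteriorPowerMap n φ =
      exteriorPower.alternatingMapToDual R M n (fun k => f k ∘ₗ φ) := by
  refine exteriorPower.linearMap_ext (AlternatingMap.ext fun w => ?_)
  have h : exteriorPowerMap n φ (exteriorPower.ιMulti R n w) =
      exteriorPower.ιMulti R n (φ ∘ w) :=
    Subtype.ext (map_apply_ιMulti φ w)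
  simp [h]

/-- The transvection with entry `1` at `(i, j)` adds the `j`-th coordinate to the `i`-th one. -/
theorem proj_comp_toLin'_transvection_self {R ι : Type*} [CommRing R] [Fintype ι]
    [DecidableEq ι] (i j : ι) :
    (LinearMap.proj i : Module.Dual R (ι → R)) ∘ₗ Matrix.toLin' (Matrix.transvection i j 1) =
      (LinearMap.proj i : Module.Dual R (ι → R)) + LinearMap.proj j := by
  refine LinearMap.ext fun x => ?_
  simp [Matrix.transvection, Matrix.single_mulVec]

/-- The transvection with entry `1` at `(i, j)` fixes all coordinates but the `i`-th one. -/
theorem proj_comp_toLin'_transvection_of_ne {R ι : Type*} [CommRing R] [Fintype ι]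
    [DecidableEq ι] (i j : ι) {k : ι} (hk : k ≠ i) :
    (LinearMap.proj k : Module.Dual R (ι → R)) ∘ₗ Matrix.toLin' (Matrix.transvection i j 1) =
      LinearMap.proj k := by
  refine LinearMap.ext fun x => ?_
  simp [Matrix.transvection, Matrix.single_mulVec, hk]

/-- Replacing the coordinate `c p` by a coordinate `i` outside the range of `c` and applying the
transvection `x_i ↦ x_i + x_{c p}` recovers the original pairing, up to the replaced one. -/
theorem alternatingMapToDual_update_comp_transvection {R ι : Type*} [CommRing R] [Fintype ι]
    [DecidableEq ι] {n : ℕ} (c : Fin n → ι) (p : Fin n) {i : ι} (hi : i ∉ Set.range c) :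
    let f : Fin n → Module.Dual R (ι → R) := fun k => LinearMap.proj (c k)
    let ψ := exteriorPower.alternatingMapToDual R (ι → R) n
    ψ (Function.update f p (LinearMap.proj i)) ∘ₗ
        exteriorPowerMap n (Matrix.toLin' (Matrix.transvection i (c p) 1)) =
      ψ (Function.update f p (LinearMap.proj i)) + ψ f := by
  intro f ψ
  have h : (fun k => Function.update f p (LinearMap.proj i) k ∘ₗ
      Matrix.toLin' (Matrix.transvection i (c p) 1)) =
      Function.update f p (LinearMap.proj i + f p) := by
    funext k
    by_cases hk : k = p
    · subst hk
      simp [f, proj_comp_toLin'_transvection_self]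
    · have hc : c k ≠ i := fun h => hi ⟨k, h⟩
      simp [f, hk, proj_comp_toLin'_transvection_of_ne i (c p) hc]
  rw [alternatingMapToDual_comp_exteriorPowerMap, h, AlternatingMap.map_update_add,
    Function.update_eq_self]

set_option synthInstance.maxHeartbeats 1000000 in
/-- For `d ≥ 2`, `0 < r < d` and a nontrivial finitely generated abelian group `A`, the
`SL_d(ℤ)`-module `Λ^r(ℤ^d) ⊗ A` (with the action induced by the standard action on `ℤ^d`,
and trivial action on `A`) has no nonzero invariants. -/
theorem no_invariants_in_exterior_power_tensor (d r : ℕ) (hd : 2 ≤ d) (hr0 : 0 < r)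
    (hrd : r < d) (A : Type*) [AddCommGroup A] [AddGroup.FG A] [Nontrivial A]
    (v : (⋀[ℤ]^r (Fin d → ℤ)) ⊗[ℤ] A)
    (hv : ∀ g : Matrix.SpecialLinearGroup (Fin d) ℤ,
      TensorProduct.map
        (exteriorPowerMap r (Matrix.toLin' (g : Matrix (Fin d) (Fin d) ℤ)))
        (LinearMap.id (R := ℤ) (M := A)) v = v) :
    v = 0 := by
  let b := Pi.basisFun ℤ (Fin d)
  apply (TensorProduct.equivFinsuppOfBasisLeft (b.exteriorPower r) (N := A)).injective
  rw [map_zero]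
  ext s
  rw [TensorProduct.equivFinsuppOfBasisLeft_apply, Finsupp.zero_apply,
    exteriorPower.basis_coord]
  let c : Fin r → Fin d := Set.powersetCard.ofFinEmbEquiv.symm s
  have hs : exteriorPower.ιMultiDual ℤ r b s =
      exteriorPower.alternatingMapToDual ℤ (Fin d → ℤ) r (fun k => LinearMap.proj (c k)) := by
    refine exteriorPower.linearMap_ext (AlternatingMap.ext fun w => ?_)
    simp [b, c]
  obtain ⟨i, hi⟩ : ∃ i, i ∉ Set.range c := by
    by_contra! h
    have := Fintype.card_le_of_surjective c h
    simp only [Fintype.card_fin] at this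
    omega
  let p : Fin r := ⟨0, hr0⟩
  have hip : i ≠ c p := fun h => hi ⟨p, h.symm⟩
  have key := alternatingMapToDual_update_comp_transvection (R := ℤ) c p hi
  dsimp only at key
  rw [← hs] at key
  have hg := hv ⟨Matrix.transvection i (c p) 1, Matrix.det_transvection_of_ne i (c p) hip 1⟩
  set χ := exteriorPower.alternatingMapToDual ℤ (Fin d → ℤ) r
    (Function.update (fun k => LinearMap.proj (c k)) p (LinearMap.proj i))
  have hχ := congrArg (LinearMap.rTensor A χ) hg
  rw [← LinearMap.rTensor_def, ← LinearMap.comp_apply, ← LinearMap.rTensor_comp, key,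
    LinearMap.rTensor_add, LinearMap.add_apply, add_eq_left] at hχ
  rw [hχ, map_zero]
end

section
/- For d ≥ 2 and 0 < r < d and n ≥ 2, if v ∈ Λ^r((ℤ/n)^d) is fixed by every elementary matrix E_{ij} (acting via the standard action of SL_d(ℤ) reduced mod n), then v = 0. -/
open ExteriorAlgebra

/-- On decomposable elements, `exteriorPowerMap` applies the endomorphism to each factor. -/
theorem exteriorPowerMap_apply_ιMulti {R M : Type*} [CommRing R] [AddCommGroup M] [Module R M]
    {n : ℕ} (f : M →ₗ[R] M) (m : Fin n → M) :
    exteriorPowerMap n f (exteriorPower.ιMulti R n m) = exteriorPower.ιMulti R n (f ∘ m) :=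
  Subtype.ext (ExteriorAlgebra.map_apply_ιMulti f m)

/-- Pairing with the image of an element under an endomorphism is pairing with the
dual forms pulled back along it. -/
theorem pairingDual_ιMulti_exteriorPowerMap {R M : Type*} [CommRing R] [AddCommGroup M]
    [Module R M] {n : ℕ} (φ : Fin n → Module.Dual R M) (f : M →ₗ[R] M) (x : ⋀[R]^n M) :
    exteriorPower.pairingDual R M n (exteriorPower.ιMulti R n φ) (exteriorPowerMap n f x) =
      exteriorPower.pairingDual R M n (exteriorPower.ιMulti R n fun k => φ k ∘ₗ f) x := by
  refine LinearMap.congr_fun (f := exteriorPower.pairingDual R M n (exteriorPower.ιMulti R n φ) ∘ₗ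
    exteriorPowerMap n f) (exteriorPower.linearMap_ext ?_) x
  ext m
  simp [exteriorPowerMap_apply_ιMulti, exteriorPower.pairingDual_ιMulti_ιMulti]

/-- Pulling back a coordinate form along the transvection `E_{ij}` changes only the `i`-th form,
to which it adds the `j`-th one. -/
theorem proj_comp_toLin'_transvection {R ι : Type*} [CommRing R] [Fintype ι] [DecidableEq ι]
    (i j k : ι) :
    (LinearMap.proj k : (ι → R) →ₗ[R] R) ∘ₗ Matrix.toLin' (Matrix.transvection i j (1 : R)) =
      LinearMap.proj k + if k = i then (LinearMap.proj j : (ι → R) →ₗ[R] R) else 0 := by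
  ext x
  by_cases h : k = i
  · simp [Matrix.transvection, Matrix.single_apply, Pi.single_apply, h]
  · simp [Matrix.transvection, h, Ne.symm h]

/-- If `x` is fixed by the transvection `E_{ij}` with `j = a k` and `i` outside the range of `a`,
then the coordinate of `x` along the multi-index `a` vanishes. -/
theorem pairingDual_proj_eq_zero_of_transvection_fixed {R ι : Type*} [CommRing R] [Fintype ι]
    [DecidableEq ι] {r : ℕ} (a : Fin r → ι) (k : Fin r) {i : ι} (hi : ∀ l, a l ≠ i)
    (x : ⋀[R]^r (ι → R))
    (hx : exteriorPowerMap r (Matrix.toLin' (Matrix.transvection i (a k) (1 : R))) x = x) :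
    exteriorPower.pairingDual R (ι → R) r
      (exteriorPower.ιMulti R r fun l => LinearMap.proj (a l)) x = 0 := by
  let e (j : ι) : Module.Dual R (ι → R) := LinearMap.proj j
  let p (l : Fin r) : Module.Dual R (ι → R) := e (a l)
  have hpull : (fun l => Function.update p k (e i) l ∘ₗ
      Matrix.toLin' (Matrix.transvection i (a k) (1 : R))) =
      Function.update p k (e i + e (a k)) := by
    funext l
    by_cases h : l = k
    · subst h
      simp [e, proj_comp_toLin'_transvection]
    · simp [h, p, e, proj_comp_toLin'_transvection, hi]
  have hpair := pairingDual_ιMulti_exteriorPowerMap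
    (Function.update p k (e i)) (Matrix.toLin' (Matrix.transvection i (a k) (1 : R))) x
  rw [hx, hpull, AlternatingMap.map_update_add, map_add, LinearMap.add_apply, left_eq_add] at hpair
  rwa [show Function.update p k (e (a k)) = p from Function.update_eq_self k p] at hpair

/-- For `d ≥ 2`, `0 < r < d` and `n ≥ 2`, if `v ∈ Λ^r((ℤ/n)^d)` is fixed by every elementary
matrix `E_{ij}` (acting via the standard action), then `v = 0`. -/
theorem no_elementary_invariants_in_exterior_power_mod_n (d r n : ℕ) (hd : 2 ≤ d)
    (hr0 : 0 < r) (hrd : r < d) (hn : 2 ≤ n)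
    (v : ⋀[ZMod n]^r (Fin d → ZMod n))
    (hv : ∀ i j : Fin d, i ≠ j →
      exteriorPowerMap r (Matrix.toLin' (Matrix.transvection i j (1 : ZMod n))) v = v) :
    v = 0 := by
  refine ((Pi.basisFun (ZMod n) (Fin d)).exteriorPower r).ext_elem fun s => ?_
  rw [exteriorPower.basis_repr_apply, map_zero, Finsupp.zero_apply]
  let a : Fin r → Fin d := Set.powersetCard.ofFinEmbEquiv.symm s
  obtain ⟨i, hi⟩ : ∃ i, ∀ l, a l ≠ i := by
    by_contra! h
    have := Fintype.card_le_of_surjective a h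
    simp only [Fintype.card_fin] at this
    omega
  have hzero := pairingDual_proj_eq_zero_of_transvection_fixed a ⟨0, hr0⟩ hi v
    (hv _ _ (hi _).symm)
  have hcoord : (Pi.basisFun (ZMod n) (Fin d)).coord ∘ a = fun l => LinearMap.proj (a l) := by
    ext
    simp
  rwa [← hcoord] at hzero
end
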